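/- Let f ∈ 𝒜* be a non-renormalizable unimodal map with a non-periodic recurrent critical point c such that ω(c) is minimal. Let Y be a symmetric nice interval, let 𝒴 denote the nice cover of ω(c) associated to Y, and let q(𝒴, n) be the number of components of f^{-n}(Y ∪ D(Y)) intersecting ω(c). Then q(𝒴, n) ≥ κ₀·n holds for all n large enough, where κ₀ > 0 is a universal constant. -/

import Mathlib

open Set Function MeasureTheory Filter Topology
open scoped Classical

noncomputable section

/-- Length (Lebesgue measure) of a set of reals. -/
def len (S : Set ℝ) : ℝ := (volume S).toReal

/-- A bounded open interval. -/
def IsOpenInterval (S : Set ℝ) : Prop := ∃ a b : ℝ, a < b ∧ S = Set.Ioo a b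

/-- The ω-limit set of a point under iteration of `f`. -/
def omegaLimitSet (f : ℝ → ℝ) (x : ℝ) : Set ℝ :=
  ⋂ N : ℕ, closure ((fun n => f^[n] x) '' {n : ℕ | N ≤ n})

/-- Unimodal maps of class 𝒜 with turning point `c`, which is non-flat of order `ℓ`:
continuous on `[0,1]`, strictly increasing on `[0,c]`, strictly decreasing on `[c,1]`,
`C³` outside `c` with non-vanishing derivative, and `|ψ⁻¹ ∘ f ∘ φ (x)| = |x|^ℓ`
near `0` for `C³` local diffeomorphisms `φ, ψ` with `φ 0 = c`, `ψ 0 = f c`. -/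
structure UnimodalA (f : ℝ → ℝ) (c ℓ : ℝ) : Prop where
  cont : ContinuousOn f (Set.Icc 0 1)
  maps : Set.MapsTo f (Set.Icc 0 1) (Set.Icc 0 1)
  c_mem : c ∈ Set.Ioo (0:ℝ) 1
  mono : StrictMonoOn f (Set.Icc 0 c)
  anti : StrictAntiOn f (Set.Icc c 1)
  smooth : ContDiffOn ℝ 3 f (Set.Icc 0 1 \ {c})
  deriv_ne : ∀ x ∈ Set.Icc 0 1 \ {c}, deriv f x ≠ 0
  ell_gt_one : 1 < ℓ
  nonflat : ∃ φ ψ : ℝ → ℝ, φ 0 = c ∧ ψ 0 = f c ∧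
    (∃ U ∈ 𝓝 (0:ℝ), ContDiffOn ℝ 3 φ U ∧ ContDiffOn ℝ 3 ψ U) ∧
    deriv φ 0 ≠ 0 ∧ deriv ψ 0 ≠ 0 ∧
    ∃ s : ℝ, |s| = 1 ∧ ∀ᶠ x in 𝓝 (0:ℝ), f (φ x) = ψ (s * |x| ^ ℓ)

/-- All periodic points of `f` in `[0,1]` are hyperbolic repelling. -/
def AllPeriodicHyperbolicRepelling (f : ℝ → ℝ) : Prop :=
  ∀ x ∈ Set.Icc (0:ℝ) 1, ∀ p : ℕ, 0 < p → f^[p] x = x → 1 < |deriv (f^[p]) x|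

/-- The class 𝒜₊ : maps in 𝒜 with all periodic points hyperbolic repelling. -/
def UnimodalAStar (f : ℝ → ℝ) (c ℓ : ℝ) : Prop :=
  UnimodalA f c ℓ ∧ AllPeriodicHyperbolicRepelling f

/-- A (minimal) metric attractor: a compact invariant set whose realm of attraction has
positive Lebesgue measure, while no proper compact invariant subset has this property. -/
def IsMetricAttractor (f : ℝ → ℝ) (X : Set ℝ) : Prop :=
  IsCompact X ∧ X ⊆ Set.Icc 0 1 ∧ f '' X ⊆ X ∧
  0 < volume {x ∈ Set.Icc (0:ℝ) 1 | omegaLimitSet f x ⊆ X} ∧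
  ∀ X' : Set ℝ, X' ⊂ X → IsCompact X' → f '' X' ⊆ X' →
    volume {x ∈ Set.Icc (0:ℝ) 1 | omegaLimitSet f x ⊆ X'} = 0

/-- A Cantor set: nonempty, compact, perfect, totally disconnected. -/
def IsCantorSet (X : Set ℝ) : Prop :=
  X.Nonempty ∧ IsCompact X ∧ Perfect X ∧ IsTotallyDisconnected X

/-- A nice interval: an open interval `T ⊆ [0,1]` such that the forward orbit of `∂T`
never enters `T`, and `T` contains no fixed point of `f`. -/
def IsNiceInterval (f : ℝ → ℝ) (T : Set ℝ) : Prop :=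
  IsOpenInterval T ∧ T ⊆ Set.Icc 0 1 ∧
  (∀ n : ℕ, ∀ x ∈ frontier T, f^[n] x ∉ T) ∧
  (∀ x ∈ T, f x ≠ x)

/-- A symmetric nice interval containing `c`: `f(∂T)` is a single point. -/
def IsSymmNice (f : ℝ → ℝ) (c : ℝ) (T : Set ℝ) : Prop :=
  IsNiceInterval f T ∧ c ∈ T ∧ ∃ y : ℝ, ∀ x ∈ frontier T, f x = y

/-- `D(T)`: the set of points entering `T` under some positive iterate. -/
def entryDomain (f : ℝ → ℝ) (T : Set ℝ) : Set ℝ :=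
  {x | ∃ k : ℕ, 1 ≤ k ∧ f^[k] x ∈ T}

/-- The return domain of `T` containing `x` (component of `D(T) ∩ T`). -/
def returnDomain (f : ℝ → ℝ) (T : Set ℝ) (x : ℝ) : Set ℝ :=
  connectedComponentIn (entryDomain f T ∩ T) x

/-- `U` is a return domain of `T`. -/
def IsReturnDomain (f : ℝ → ℝ) (T U : Set ℝ) : Prop :=
  ∃ x ∈ entryDomain f T ∩ T, U = returnDomain f T x

/-- `k` is the first return time of `x` to `T`. -/
def IsFirstReturnTime (f : ℝ → ℝ) (T : Set ℝ) (x : ℝ) (k : ℕ) : Prop :=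
  1 ≤ k ∧ f^[k] x ∈ T ∧ ∀ j : ℕ, 1 ≤ j → j < k → f^[j] x ∉ T

/-- `J` is a pull back of `V` by `f^k`, i.e. a connected component of `f^{-k}(V)`. -/
def IsPullbackBy (f : ℝ → ℝ) (V J : Set ℝ) (k : ℕ) : Prop :=
  ∃ x ∈ f^[k] ⁻¹' V, J = connectedComponentIn (f^[k] ⁻¹' V) x

/-- `J` is a child of `T` with transition time `k`: a unimodal pull back of `T`
containing `c`, i.e. `f^{k-1}` maps a neighborhood of `f(J)` diffeomorphically
(injectively) onto `T`. -/
def IsChildWithTime (f : ℝ → ℝ) (c : ℝ) (T J : Set ℝ) (k : ℕ) : Prop :=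
  1 ≤ k ∧ c ∈ J ∧ IsPullbackBy f T J k ∧
  ∃ W : Set ℝ, IsOpen W ∧ f '' J ⊆ W ∧ Set.InjOn (f^[k - 1]) W ∧ f^[k - 1] '' W = T

/-- `J` is a child of `T`. -/
def IsChild (f : ℝ → ℝ) (c : ℝ) (T J : Set ℝ) : Prop :=
  ∃ k : ℕ, IsChildWithTime f c T J k

/-- The number `ν(T)` of children of `T`. -/
def numChildren (f : ℝ → ℝ) (c : ℝ) (T : Set ℝ) : ℕ :=
  {J : Set ℝ | IsChild f c T J}.ncard

/-- The interval `J` is `τ`-well inside the interval `I`: both components of `I ∖ J`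
have length at least `τ·|J|`. -/
def WellInside (τ : ℝ) (J I : Set ℝ) : Prop :=
  ∃ a b a' b' : ℝ, a' ≤ a ∧ a < b ∧ b ≤ b' ∧ J = Set.Ioo a b ∧ I = Set.Ioo a' b' ∧
    τ * (b - a) ≤ a - a' ∧ τ * (b - a) ≤ b' - b

/-- A `τ`-nice interval: every return domain is `τ`-well inside it. -/
def IsTauNice (f : ℝ → ℝ) (τ : ℝ) (T : Set ℝ) : Prop :=
  ∀ x ∈ entryDomain f T ∩ T, WellInside τ (returnDomain f T x) T

/-- A `τ`-non-central-nice interval: every return domain, except possibly the one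
containing `c`, is `τ`-well inside it. -/
def IsNonCentralTauNice (f : ℝ → ℝ) (c : ℝ) (τ : ℝ) (T : Set ℝ) : Prop :=
  ∀ x ∈ entryDomain f T ∩ T, c ∉ returnDomain f T x →
    WellInside τ (returnDomain f T x) T

/-- `I` is a restrictive interval of period `s` for `f`. -/
def IsRenormInterval (f : ℝ → ℝ) (c : ℝ) (I : Set ℝ) (s : ℕ) : Prop :=
  (∃ a b : ℝ, a < b ∧ I = Set.Icc a b) ∧ c ∈ interior I ∧ 2 ≤ s ∧
  (∀ i j : ℕ, i < j → j < s → interior (f^[i] '' I) ∩ interior (f^[j] '' I) = ∅) ∧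
  f^[s] '' I ⊆ I ∧ f^[s] '' frontier I ⊆ frontier I

/-- `f` is renormalizable. -/
def Renormalizable (f : ℝ → ℝ) (c : ℝ) : Prop :=
  ∃ I s, IsRenormInterval f c I s

/-- `f` is infinitely renormalizable: restrictive intervals of arbitrarily large period. -/
def InfinitelyRenormalizable (f : ℝ → ℝ) (c : ℝ) : Prop :=
  ∀ N : ℕ, ∃ I s, N ≤ s ∧ IsRenormInterval f c I s

/-- `X` is a minimal set for `f`. -/
def IsMinimalOn (f : ℝ → ℝ) (X : Set ℝ) : Prop :=
  X.Nonempty ∧ IsClosed X ∧ f '' X ⊆ X ∧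
  ∀ x ∈ X, X ⊆ closure {y | ∃ n : ℕ, f^[n] x = y}

/-- The collection of connected components of `S` which intersect `ω(c)`. -/
def componentsMeeting (f : ℝ → ℝ) (c : ℝ) (S : Set ℝ) : Set (Set ℝ) :=
  {U | (∃ x ∈ S, U = connectedComponentIn S x) ∧ (U ∩ omegaLimitSet f c).Nonempty}

/-- The nice cover 𝒴 of `ω(c)` associated with a symmetric nice interval `Y`:
components of `Y ∪ D(Y)` meeting `ω(c)`. -/
def niceCover (f : ℝ → ℝ) (c : ℝ) (Y : Set ℝ) : Set (Set ℝ) :=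
  componentsMeeting f c (Y ∪ entryDomain f Y)

/-- `q(𝒴, n)`: the number of components of `f^{-n}(Y ∪ D(Y))` intersecting `ω(c)`. -/
def qCount (f : ℝ → ℝ) (c : ℝ) (Y : Set ℝ) (n : ℕ) : ℕ :=
  (componentsMeeting f c (f^[n] ⁻¹' (Y ∪ entryDomain f Y))).ncard

/-- `Y₋ₙ`: the component of `f^{-n}(Y ∪ D(Y))` containing `c`. -/
def criticalPullbackOfEntry (f : ℝ → ℝ) (c : ℝ) (Y : Set ℝ) (n : ℕ) : Set ℝ :=
  connectedComponentIn (f^[n] ⁻¹' (Y ∪ entryDomain f Y)) c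

/-- `𝒰` is an open cover of `X`. -/
def IsOpenCover (X : Set ℝ) (𝒰 : Set (Set ℝ)) : Prop :=
  (∀ U ∈ 𝒰, IsOpen U) ∧ X ⊆ ⋃₀ 𝒰

/-- The cover `⋁_{i=0}^{n-1} f^{-i} 𝒰`. -/
def coverJoin (f : ℝ → ℝ) (𝒰 : Set (Set ℝ)) (n : ℕ) : Set (Set ℝ) :=
  {V | ∃ U : Fin n → Set ℝ, (∀ i, U i ∈ 𝒰) ∧ V = ⋂ i : Fin n, f^[(i : ℕ)] ⁻¹' U i}

/-- The topological complexity function `p(𝒰, n) = N(⋁_{i=0}^{n-1} f^{-i} 𝒰)`: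
the minimal cardinality of a finite subcover of `X` from the joined cover. -/
def complexity (f : ℝ → ℝ) (X : Set ℝ) (𝒰 : Set (Set ℝ)) (n : ℕ) : ℕ :=
  sInf {m : ℕ | ∃ 𝒱 : Set (Set ℝ), 𝒱 ⊆ coverJoin f 𝒰 n ∧ 𝒱.Finite ∧
        X ⊆ ⋃₀ 𝒱 ∧ 𝒱.ncard = m}

/-- A maximal central cascade `T⁰ ⊃ T¹ ⊃ ⋯ ⊃ Tᵐ` with common first return time `s`. -/
def IsMaximalCentralCascade (f : ℝ → ℝ) (c : ℝ) (T : ℕ → Set ℝ) (m s : ℕ) : Prop :=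
  1 ≤ m ∧ 1 ≤ s ∧ (∀ i ≤ m, IsSymmNice f c (T i)) ∧
  (∀ i < m, T (i + 1) = returnDomain f (T i) c) ∧
  (∀ i < m, IsFirstReturnTime f (T i) c s) ∧ f^[s] c ∉ T m

/-- `Λ`: the union of the components of `I ∪ D(I)` which intersect `ω(c)`. -/
def LambdaSet (f : ℝ → ℝ) (c : ℝ) (I : Set ℝ) : Set ℝ :=
  {x | x ∈ I ∪ entryDomain f I ∧
       (connectedComponentIn (I ∪ entryDomain f I) x ∩ omegaLimitSet f c).Nonempty}

/-- `Λ(T)`: points which enter `T` while staying in `Λ` before doing so. -/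
def LambdaT (f : ℝ → ℝ) (c : ℝ) (I T : Set ℝ) : Set ℝ :=
  {x | ∃ k : ℕ, 1 ≤ k ∧ (∀ j < k, f^[j] x ∈ LambdaSet f c I) ∧ f^[k] x ∈ T}

/-- The fixed base interval `I`: a symmetric nice interval containing `c` such that
the associated `Λ` is compactly contained in `[f²(c), f(c)]`. -/
def GoodBase (f : ℝ → ℝ) (c : ℝ) (I : Set ℝ) : Prop :=
  IsSymmNice f c I ∧ closure (LambdaSet f c I) ⊆ Set.Ioo (f (f c)) (f c)

/-- `λ(Y'|Y)`: the supremum over diffeomorphisms `f^s : J → Y` of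
`|(f^s|J)^{-1}(Y')| / |J|`. -/
def lamRatio (f : ℝ → ℝ) (Y' Y : Set ℝ) : ℝ :=
  sSup {r : ℝ | ∃ (s : ℕ) (J : Set ℝ), IsOpenInterval J ∧
        Set.InjOn (f^[s]) J ∧ f^[s] '' J = Y ∧
        r = len (J ∩ f^[s] ⁻¹' Y') / len J}

/-- `ξ(Y'|Y) = 1 − λ(Y'|Y)`. -/
def xiRel (f : ℝ → ℝ) (Y' Y : Set ℝ) : ℝ := 1 - lamRatio f Y' Y

/-- The empty space `ξ(T) = ξ(Λ(T) ∩ T | T)`. -/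
def xiT (f : ℝ → ℝ) (c : ℝ) (I T : Set ℝ) : ℝ :=
  xiRel f (LambdaT f c I T ∩ T) T

/-- `Y_{-j}` in the chain of pull backs of `Y` along the orbit `c, f(c), …, fⁿ(c)`:
the component of `f^{-j}(Y)` containing `f^{n-j}(c)`. -/
def chainAt (f : ℝ → ℝ) (c : ℝ) (Y : Set ℝ) (n j : ℕ) : Set ℝ :=
  connectedComponentIn (f^[j] ⁻¹' Y) (f^[n - j] c)

/-- The set of transition times `s_j` occurring in the chain from `Y_{-n}` to `Y`:
gaps between consecutive critical positions in the chain. -/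
def essentialTimes (f : ℝ → ℝ) (c : ℝ) (Y : Set ℝ) (n : ℕ) : Set ℕ :=
  {s : ℕ | ∃ j j' : ℕ, j < j' ∧ j' ≤ n ∧ c ∈ chainAt f c Y n j ∧ c ∈ chainAt f c Y n j' ∧
    (∀ i : ℕ, j < i → i < j' → c ∉ chainAt f c Y n i) ∧ s = j' - j}

/-- The essential order `M_n(Y)`: the number of distinct transition times in the chain. -/
def essentialOrder (f : ℝ → ℝ) (c : ℝ) (Y : Set ℝ) (n : ℕ) : ℕ :=
  (essentialTimes f c Y n).ncard

/-- The first (largest) child of `T`. -/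
def IsFirstChild (f : ℝ → ℝ) (c : ℝ) (T J : Set ℝ) : Prop :=
  IsChild f c T J ∧ ∀ J', IsChild f c T J' → J' ⊆ J

/-- The second child of `T`: the second largest child. -/
def IsSecondChild (f : ℝ → ℝ) (c : ℝ) (T J : Set ℝ) : Prop :=
  IsChild f c T J ∧ ∃ J₁, IsFirstChild f c T J₁ ∧ J ⊂ J₁ ∧
    ∀ J', IsChild f c T J' → J' ≠ J₁ → J' ⊆ J

/-- The principal nest `Y = Y₀ ⊃ Y₁ ⊃ ⋯` starting from `Y`. -/
def principalNest (f : ℝ → ℝ) (c : ℝ) (Y : Set ℝ) : ℕ → Set ℝ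
  | 0 => Y
  | n + 1 => returnDomain f (principalNest f c Y n) c

/-- `f` has special combinatorics, witnessed by the symmetric nice interval `Y`:
`ω(c) ∋ c` is minimal and each annulus `Yₙ ∖ Yₙ₊₁` of the principal nest has
exactly one component intersecting `ω(c)`. -/
def SpecialCombinatorics (f : ℝ → ℝ) (c : ℝ) (Y : Set ℝ) : Prop :=
  c ∈ omegaLimitSet f c ∧ IsMinimalOn f (omegaLimitSet f c) ∧ IsSymmNice f c Y ∧
  ∀ n : ℕ, ∃! U : Set ℝ,
    U ∈ componentsMeeting f c (principalNest f c Y n \ principalNest f c Y (n + 1))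

/-- The adding machine map `f_α` on `Δ_α = Π i, {0, …, pᵢ − 1}`. -/
def addingMachine (p : ℕ → ℕ) (hp : ∀ i, 2 ≤ p i) (x : ∀ i, Fin (p i)) :
    ∀ i, Fin (p i) :=
  if h : ∃ l, (x l : ℕ) + 1 < p l then fun i =>
    if i < Nat.find h then ⟨0, by have := hp i; omega⟩
    else if hi : i = Nat.find h then
      ⟨(x i : ℕ) + 1, by rw [hi]; exact Nat.find_spec h⟩
    else x i
  else fun i => ⟨0, by have := hp i; omega⟩

/-- `f` restricted to `X` is topologically conjugate to an adding machine. -/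
def ConjugateToAddingMachine (f : ℝ → ℝ) (X : Set ℝ) : Prop :=
  ∃ (p : ℕ → ℕ) (hp : ∀ i, 2 ≤ p i) (φ : ℝ → ∀ i, Fin (p i)),
    ContinuousOn φ X ∧ Set.InjOn φ X ∧ φ '' X = Set.univ ∧
    ∀ x ∈ X, φ (f x) = addingMachine p hp (φ x)

/-- `f` restricted to `X` is equicontinuous (w.r.t. all iterates). -/
def EquicontinuousOnSet (f : ℝ → ℝ) (X : Set ℝ) : Prop :=
  ∀ ε > 0, ∃ δ > 0, ∀ x ∈ X, ∀ y ∈ X, |x - y| < δ →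
    ∀ n : ℕ, |f^[n] x - f^[n] y| < ε

/-- The points whose orbit visits `Y` at some time `k ≥ n`. -/
def lateVisits (f : ℝ → ℝ) (Y : Set ℝ) (n : ℕ) : Set ℝ := f^[n] ⁻¹' (Y ∪ entryDomain f Y)

theorem mem_lateVisits {f : ℝ → ℝ} {Y : Set ℝ} {n : ℕ} {x : ℝ} :
    x ∈ lateVisits f Y n ↔ ∃ k, n ≤ k ∧ f^[k] x ∈ Y := by
  constructor
  · rintro (h | ⟨k, -, h⟩)
    · exact ⟨n, le_rfl, h⟩
    · exact ⟨k + n, by omega, by rwa [iterate_add_apply]⟩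
  · rintro ⟨k, hk, h⟩
    obtain ⟨j, rfl⟩ := Nat.exists_eq_add_of_le' hk
    rw [iterate_add_apply] at h
    rcases Nat.eq_zero_or_pos j with rfl | hj
    · exact Or.inl h
    · exact Or.inr ⟨j, hj, h⟩

theorem lateVisits_antitone (f : ℝ → ℝ) (Y : Set ℝ) : Antitone (lateVisits f Y) := by
  intro m n hmn x hx
  obtain ⟨k, hk, h⟩ := mem_lateVisits.1 hx
  exact mem_lateVisits.2 ⟨k, hmn.trans hk, h⟩

theorem iterate_mem_lateVisits {f : ℝ → ℝ} {Y : Set ℝ} {n : ℕ} (j : ℕ) {x : ℝ} :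
    f^[j] x ∈ lateVisits f Y n ↔ x ∈ lateVisits f Y (n + j) := by
  simp only [lateVisits, mem_preimage, iterate_add_apply]

theorem apply_mem_lateVisits {f : ℝ → ℝ} {Y : Set ℝ} {n : ℕ} {x : ℝ} :
    f x ∈ lateVisits f Y n ↔ x ∈ lateVisits f Y (n + 1) :=
  iterate_mem_lateVisits 1

/-- `x` and `y` are joined by an interval of points visiting `Y` at some time `k ≥ n`. -/
def LateJoined (f : ℝ → ℝ) (Y : Set ℝ) (n : ℕ) (x y : ℝ) : Prop := uIcc x y ⊆ lateVisits f Y n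

namespace LateJoined

variable {f : ℝ → ℝ} {Y : Set ℝ} {m n : ℕ} {x y z : ℝ}

theorem symm (h : LateJoined f Y n x y) : LateJoined f Y n y x := by
  rwa [LateJoined, uIcc_comm]

theorem trans (h : LateJoined f Y n x y) (h' : LateJoined f Y n y z) : LateJoined f Y n x z :=
  uIcc_subset_uIcc_union_uIcc.trans (union_subset h h')

theorem anti (hmn : m ≤ n) (h : LateJoined f Y n x y) : LateJoined f Y m x y :=
  Subset.trans h (lateVisits_antitone f Y hmn)

theorem image (hc : ContinuousOn f (uIcc x y)) (h : LateJoined f Y (n + 1) x y) :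
    LateJoined f Y n (f x) (f y) := by
  intro w hw
  obtain ⟨z, hz, rfl⟩ := intermediate_value_uIcc hc hw
  exact apply_mem_lateVisits.2 (h hz)

theorem image_iterate (hc : ContinuousOn f^[m] (uIcc x y)) (h : LateJoined f Y (n + m) x y) :
    LateJoined f Y n (f^[m] x) (f^[m] y) := by
  intro w hw
  obtain ⟨z, hz, rfl⟩ := intermediate_value_uIcc hc hw
  exact (iterate_mem_lateVisits m).2 (h hz)

theorem of_image (hf : MapsTo f (uIcc x y) (uIcc (f x) (f y))) (h : LateJoined f Y n (f x) (f y)) :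
    LateJoined f Y (n + 1) x y :=
  fun _ hz => apply_mem_lateVisits.1 (h (hf hz))

theorem connectedComponentIn_eq_iff (hx : x ∈ lateVisits f Y n) (hy : y ∈ lateVisits f Y n) :
    connectedComponentIn (lateVisits f Y n) x = connectedComponentIn (lateVisits f Y n) y ↔
      LateJoined f Y n x y := by
  constructor
  · intro h
    have hy' := mem_connectedComponentIn hy
    rw [← h] at hy'
    exact (isPreconnected_connectedComponentIn.ordConnected.uIcc_subset
      (mem_connectedComponentIn hx) hy').trans (connectedComponentIn_subset _ _)
  · intro h
    exact connectedComponentIn_eq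
      (isPreconnected_uIcc.subset_connectedComponentIn left_mem_uIcc h right_mem_uIcc)

end LateJoined

theorem UnimodalA.continuousOn_iterate {f : ℝ → ℝ} {c ℓ : ℝ} (hf : UnimodalA f c ℓ) (k : ℕ) :
    ContinuousOn f^[k] (Icc 0 1) :=
  hf.cont.iterate hf.maps k

theorem UnimodalA.le_apply_turning {f : ℝ → ℝ} {c ℓ : ℝ} (hf : UnimodalA f c ℓ) {x : ℝ}
    (hx : x ∈ Icc (0 : ℝ) 1) : f x ≤ f c := by
  have hc := hf.c_mem
  rcases le_total x c with h | h
  · exact hf.mono.monotoneOn ⟨hx.1, h⟩ ⟨hc.1.le, le_rfl⟩ h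
  · exact hf.anti.antitoneOn ⟨le_rfl, hc.2.le⟩ ⟨h, hx.2⟩ h

theorem omegaLimitSet_subset_of_isClosed {f : ℝ → ℝ} {x : ℝ} {K : Set ℝ} (hK : IsClosed K) (N : ℕ)
    (h : ∀ n, N ≤ n → f^[n] x ∈ K) : omegaLimitSet f x ⊆ K :=
  (iInter_subset _ N).trans (closure_minimal (image_subset_iff.2 h) hK)

/-- The combinatorial setting: a unimodal map with recurrent non-periodic turning point `c` whose
ω-limit set is minimal, and a symmetric nice interval `Ioo u v`. -/
structure NiceSetting (f : ℝ → ℝ) (c ℓ u v : ℝ) : Prop where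
  unimodal : UnimodalA f c ℓ
  recurrent : c ∈ omegaLimitSet f c
  nonperiodic : ∀ p : ℕ, 1 ≤ p → f^[p] c ≠ c
  minimal : IsMinimalOn f (omegaLimitSet f c)
  c_mem : c ∈ Ioo u v
  nonneg : 0 ≤ u
  le_one : v ≤ 1
  left_notMem : ∀ n, f^[n] u ∉ Ioo u v
  right_notMem : ∀ n, f^[n] v ∉ Ioo u v
  no_fixed : ∀ x ∈ Ioo u v, f x ≠ x

namespace NiceSetting

variable {f : ℝ → ℝ} {c ℓ u v : ℝ}

theorem c_mem_Icc (h : NiceSetting f c ℓ u v) : c ∈ Icc (0 : ℝ) 1 :=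
  Ioo_subset_Icc_self h.unimodal.c_mem

theorem omega_subset (h : NiceSetting f c ℓ u v) : omegaLimitSet f c ⊆ Icc 0 1 :=
  omegaLimitSet_subset_of_isClosed isClosed_Icc 0 fun n _ =>
    h.unimodal.maps.iterate n h.c_mem_Icc

theorem mapsTo_omega (h : NiceSetting f c ℓ u v) :
    MapsTo f (omegaLimitSet f c) (omegaLimitSet f c) :=
  mapsTo_iff_image_subset.2 h.minimal.2.2.1

theorem iterate_mem_omega (h : NiceSetting f c ℓ u v) (n : ℕ) : f^[n] c ∈ omegaLimitSet f c :=
  h.mapsTo_omega.iterate n h.recurrent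

theorem uIcc_subset_Icc (h : NiceSetting f c ℓ u v) {x y : ℝ} (hx : x ∈ omegaLimitSet f c)
    (hy : y ∈ omegaLimitSet f c) : uIcc x y ⊆ Icc 0 1 :=
  ordConnected_Icc.uIcc_subset (h.omega_subset hx) (h.omega_subset hy)

theorem omega_subset_lateVisits (h : NiceSetting f c ℓ u v) (n : ℕ) :
    omegaLimitSet f c ⊆ lateVisits f (Ioo u v) n := by
  intro x hx
  obtain ⟨_, hy, k, rfl⟩ := mem_closure_iff.1
    (h.minimal.2.2.2 _ (h.mapsTo_omega.iterate n hx) h.recurrent) _ isOpen_Ioo h.c_mem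
  exact mem_lateVisits.2 ⟨k + n, by omega, by rwa [iterate_add_apply]⟩

theorem eventually_joined (h : NiceSetting f c ℓ u v) (n : ℕ) {x : ℝ}
    (hx : x ∈ omegaLimitSet f c) :
    ∃ δ > 0, ∀ y ∈ omegaLimitSet f c, |y - x| < δ → LateJoined f (Ioo u v) n x y := by
  obtain ⟨k, hk, hkx⟩ := mem_lateVisits.1 (h.omega_subset_lateVisits n hx)
  have hev := (h.unimodal.continuousOn_iterate k) x (h.omega_subset hx)
    |>.preimage_mem_nhdsWithin (isOpen_Ioo.mem_nhds hkx)
  obtain ⟨δ, hδ, hball⟩ := Metric.mem_nhdsWithin_iff.1 hev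
  refine ⟨δ, hδ, fun y hy hyx z hz => mem_lateVisits.2 ⟨k, hk, hball ⟨?_, ?_⟩⟩⟩
  · rw [Metric.mem_ball, Real.dist_eq]
    exact (abs_sub_left_of_mem_uIcc hz).trans_lt hyx
  · exact h.uIcc_subset_Icc hx hy hz

theorem componentsMeeting_eq (h : NiceSetting f c ℓ u v) (n : ℕ) :
    componentsMeeting f c (lateVisits f (Ioo u v) n) =
      connectedComponentIn (lateVisits f (Ioo u v) n) '' omegaLimitSet f c := by
  ext U
  constructor
  · rintro ⟨⟨x, -, rfl⟩, y, hy, hyX⟩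
    exact ⟨y, hyX, (connectedComponentIn_eq hy).symm⟩
  · rintro ⟨x, hx, rfl⟩
    have hxS := h.omega_subset_lateVisits n hx
    exact ⟨⟨x, hxS, rfl⟩, x, mem_connectedComponentIn hxS, hx⟩

theorem componentsMeeting_finite (h : NiceSetting f c ℓ u v) (n : ℕ) :
    (componentsMeeting f c (lateVisits f (Ioo u v) n)).Finite := by
  have hcomp : IsCompact (omegaLimitSet f c) :=
    isCompact_Icc.of_isClosed_subset h.minimal.2.1 h.omega_subset
  have : CompactSpace (omegaLimitSet f c) := isCompact_iff_compactSpace.1 hcomp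
  have hloc : IsLocallyConstant fun x : omegaLimitSet f c =>
      connectedComponentIn (lateVisits f (Ioo u v) n) (x : ℝ) := by
    rw [IsLocallyConstant.iff_eventually_eq]
    rintro ⟨x, hx⟩
    obtain ⟨δ, hδ, hj⟩ := h.eventually_joined n hx
    filter_upwards [Metric.ball_mem_nhds (⟨x, hx⟩ : omegaLimitSet f c) hδ] with y hy
    exact ((LateJoined.connectedComponentIn_eq_iff (h.omega_subset_lateVisits n hx)
      (h.omega_subset_lateVisits n y.2)).2 (hj y y.2 hy)).symm
  rw [h.componentsMeeting_eq, image_eq_range]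
  exact hloc.range_finite

theorem qCount_pos (h : NiceSetting f c ℓ u v) (n : ℕ) : 0 < qCount f c (Ioo u v) n := by
  refine (ncard_pos (h.componentsMeeting_finite n)).2 ?_
  rw [h.componentsMeeting_eq]
  exact ⟨_, mem_image_of_mem _ h.recurrent⟩

/-- If passing from `n` to `n + 1` does not increase the number of components, it does not
separate any points of the ω-limit set. -/
theorem joined_succ_of_qCount_le (h : NiceSetting f c ℓ u v) {n : ℕ}
    (hq : qCount f c (Ioo u v) (n + 1) ≤ qCount f c (Ioo u v) n) {x y : ℝ}
    (hx : x ∈ omegaLimitSet f c) (hy : y ∈ omegaLimitSet f c) (hxy : LateJoined f (Ioo u v) n x y) :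
    LateJoined f (Ioo u v) (n + 1) x y := by
  set S := lateVisits f (Ioo u v)
  have hS := h.omega_subset_lateVisits
  let g : Set ℝ → Set ℝ := fun C =>
    if hC : (C ∩ omegaLimitSet f c).Nonempty then connectedComponentIn (S n) hC.some else ∅
  have hg : ∀ z ∈ omegaLimitSet f c,
      g (connectedComponentIn (S (n + 1)) z) = connectedComponentIn (S n) z := by
    intro z hz
    have hC : (connectedComponentIn (S (n + 1)) z ∩ omegaLimitSet f c).Nonempty :=
      ⟨z, mem_connectedComponentIn (hS _ hz), hz⟩
    simp only [g, dif_pos hC]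
    have hw := hC.some_mem
    have hj := (LateJoined.connectedComponentIn_eq_iff (hS _ hz) (hS _ hw.2)).1
      (connectedComponentIn_eq hw.1)
    exact (LateJoined.connectedComponentIn_eq_iff (hS _ hw.2) (hS _ hz)).2
      (hj.anti n.le_succ).symm
  have himg : g '' componentsMeeting f c (S (n + 1)) = componentsMeeting f c (S n) := by
    rw [h.componentsMeeting_eq, h.componentsMeeting_eq, image_image]
    exact image_congr hg
  have hfin := h.componentsMeeting_finite (n + 1)
  have hcard : (g '' componentsMeeting f c (S (n + 1))).ncard =
      (componentsMeeting f c (S (n + 1))).ncard :=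
    le_antisymm (ncard_image_le hfin) (by rw [himg]; exact hq)
  have hinj := injOn_of_ncard_image_eq hcard hfin
  have hmem : ∀ z ∈ omegaLimitSet f c,
      connectedComponentIn (S (n + 1)) z ∈ componentsMeeting f c (S (n + 1)) := fun z hz => by
    rw [h.componentsMeeting_eq]; exact mem_image_of_mem _ hz
  refine (LateJoined.connectedComponentIn_eq_iff (hS _ hx) (hS _ hy)).1
    (hinj (hmem x hx) (hmem y hy) ?_)
  rw [hg x hx, hg y hy]
  exact (LateJoined.connectedComponentIn_eq_iff (hS _ hx) (hS _ hy)).2 hxy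

/-- Points joined at time `n` remain joined at time `n + 1`. -/
def Stable (f : ℝ → ℝ) (c u v : ℝ) (n : ℕ) : Prop :=
  ∀ x ∈ omegaLimitSet f c, ∀ y ∈ omegaLimitSet f c,
    LateJoined f (Ioo u v) n x y → LateJoined f (Ioo u v) (n + 1) x y

theorem Stable.succ (h : NiceSetting f c ℓ u v) {n : ℕ} (hs : Stable f c u v n) :
    Stable f c u v (n + 1) := by
  have step : ∀ x ∈ omegaLimitSet f c, ∀ y ∈ omegaLimitSet f c,
      MapsTo f (uIcc x y) (uIcc (f x) (f y)) → LateJoined f (Ioo u v) (n + 1) x y →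
      LateJoined f (Ioo u v) (n + 2) x y := fun x hx y hy hm hj =>
    (hs _ (h.mapsTo_omega hx) _ (h.mapsTo_omega hy)
      (hj.image (h.unimodal.cont.mono (h.uIcc_subset_Icc hx hy)))).of_image hm
  have left : ∀ x ∈ omegaLimitSet f c, ∀ y ∈ omegaLimitSet f c, x ≤ c → y ≤ c →
      LateJoined f (Ioo u v) (n + 1) x y → LateJoined f (Ioo u v) (n + 2) x y := by
    intro x hx y hy hxc hyc
    refine step x hx y hy (MonotoneOn.mapsTo_uIcc (h.unimodal.mono.monotoneOn.mono ?_))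
    exact ordConnected_Icc.uIcc_subset ⟨(h.omega_subset hx).1, hxc⟩ ⟨(h.omega_subset hy).1, hyc⟩
  have right : ∀ x ∈ omegaLimitSet f c, ∀ y ∈ omegaLimitSet f c, c ≤ x → c ≤ y →
      LateJoined f (Ioo u v) (n + 1) x y → LateJoined f (Ioo u v) (n + 2) x y := by
    intro x hx y hy hxc hyc
    refine step x hx y hy (AntitoneOn.mapsTo_uIcc (h.unimodal.anti.antitoneOn.mono ?_))
    exact ordConnected_Icc.uIcc_subset ⟨hxc, (h.omega_subset hx).2⟩ ⟨hyc, (h.omega_subset hy).2⟩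
  have across : ∀ x ∈ omegaLimitSet f c, ∀ y ∈ omegaLimitSet f c, x ≤ c → c ≤ y →
      LateJoined f (Ioo u v) (n + 1) x y → LateJoined f (Ioo u v) (n + 2) x y := by
    intro x hx y hy hxc hyc hj
    have hc : c ∈ uIcc x y := mem_uIcc_of_le hxc hyc
    exact (left x hx c h.recurrent hxc le_rfl ((uIcc_subset_uIcc_left hc).trans hj)).trans
      (right c h.recurrent y hy le_rfl hyc ((uIcc_subset_uIcc_right hc).trans hj))
  intro x hx y hy hj
  rcases le_total x c with hxc | hxc <;> rcases le_total y c with hyc | hyc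
  · exact left x hx y hy hxc hyc hj
  · exact across x hx y hy hxc hyc hj
  · exact (across y hy x hx hyc hxc hj.symm).symm
  · exact right x hx y hy hxc hyc hj

theorem Stable.joined (h : NiceSetting f c ℓ u v) {n : ℕ} (hs : Stable f c u v n) {x y : ℝ}
    (hx : x ∈ omegaLimitSet f c) (hy : y ∈ omegaLimitSet f c) (hxy : LateJoined f (Ioo u v) n x y)
    (m : ℕ) : LateJoined f (Ioo u v) m x y := by
  have hst : ∀ k, Stable f c u v (n + k) := by
    intro k
    induction k with
    | zero => exact hs
    | succ k ih => exact Stable.succ h ih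
  have hj : ∀ k, LateJoined f (Ioo u v) (n + k) x y := by
    intro k
    induction k with
    | zero => exact hxy
    | succ k ih => exact hst k x hx y hy ih
  exact (hj m).anti (by omega)

theorem iterate_ne (h : NiceSetting f c ℓ u v) {i p : ℕ} (hi : 1 ≤ i) (hp : 1 ≤ p) :
    f^[p] (f^[i] c) ≠ f^[i] c := by
  intro hper
  have hfin : {y | ∃ n : ℕ, f^[n] (f^[i] c) = y}.Finite := by
    refine ((finite_Iio p).image fun n => f^[n] (f^[i] c)).subset ?_
    rintro _ ⟨n, rfl⟩
    exact ⟨n % p, Nat.mod_lt _ hp, IsPeriodicPt.iterate_mod_apply hper n⟩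
  have hc := h.minimal.2.2.2 _ (h.iterate_mem_omega i) h.recurrent
  rw [hfin.isClosed.closure_eq] at hc
  obtain ⟨n, hn⟩ := hc
  rw [← iterate_add_apply] at hn
  exact h.nonperiodic _ (by omega) hn

theorem lt_apply (h : NiceSetting f c ℓ u v) : c < f c := by
  by_contra! hle
  have hlt : f c < c := lt_of_le_of_ne hle (h.nonperiodic 1 le_rfl)
  have hsub : omegaLimitSet f c ⊆ Iic (f c) := by
    refine omegaLimitSet_subset_of_isClosed isClosed_Iic 1 fun n hn => ?_
    obtain ⟨k, rfl⟩ := Nat.exists_eq_add_of_le' hn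
    rw [iterate_succ_apply']
    exact h.unimodal.le_apply_turning (h.unimodal.maps.iterate k h.c_mem_Icc)
  exact hlt.not_ge (hsub h.recurrent)

theorem not_joined_apply (h : NiceSetting f c ℓ u v) (n : ℕ) :
    ¬ LateJoined f (Ioo u v) n c (f c) := by
  intro hj
  have hlt := h.lt_apply
  have hsub : Icc c (f c) ⊆ Icc 0 1 := by
    rw [← uIcc_of_le hlt.le]
    exact h.uIcc_subset_Icc h.recurrent (h.iterate_mem_omega 1)
  have hcont : ContinuousOn (fun x => f x - x) (Icc c (f c)) :=
    (h.unimodal.cont.mono hsub).sub continuousOn_id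
  have hle := h.unimodal.le_apply_turning (hsub ⟨hlt.le, le_rfl⟩)
  obtain ⟨z, hz, hz0⟩ := intermediate_value_Icc' hlt.le hcont
    (show (0 : ℝ) ∈ Icc (f (f c) - f c) (f c - c) from ⟨by linarith, by linarith⟩)
  have hfix : f z = z := sub_eq_zero.1 hz0
  rw [← uIcc_of_le hlt.le] at hz
  obtain ⟨k, -, hk⟩ := mem_lateVisits.1 (hj hz)
  rw [iterate_fixed hfix] at hk
  exact h.no_fixed z hk hfix

theorem isClosed_compl_lateVisits (h : NiceSetting f c ℓ u v) (n : ℕ) {K : Set ℝ}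
    (hK : IsClosed K) (hsub : K ⊆ Icc 0 1) : IsClosed (K \ lateVisits f (Ioo u v) n) := by
  have : K \ lateVisits f (Ioo u v) n =
      K ∩ ⋂ k, ⋂ (_ : n ≤ k), (K ∩ f^[k] ⁻¹' (Ioo u v)ᶜ) := by
    ext x
    simp only [Set.mem_sdiff, mem_lateVisits, mem_inter_iff, mem_iInter, mem_preimage, mem_compl_iff,
      not_exists, not_and]
    exact ⟨fun hx => ⟨hx.1, fun k hk => ⟨hx.1, hx.2 k hk⟩⟩,
      fun hx => ⟨hx.1, fun k hk => (hx.2 k hk).2⟩⟩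
  rw [this]
  exact hK.inter <| isClosed_iInter fun k => isClosed_iInter fun _ =>
    ((h.unimodal.continuousOn_iterate k).mono hsub).preimage_isClosed_of_isClosed hK
      isOpen_Ioo.isClosed_compl

theorem left_notMem_lateVisits (h : NiceSetting f c ℓ u v) (n : ℕ) :
    u ∉ lateVisits f (Ioo u v) n := fun hu => by
  obtain ⟨k, -, hk⟩ := mem_lateVisits.1 hu
  exact h.left_notMem k hk

theorem right_notMem_lateVisits (h : NiceSetting f c ℓ u v) (n : ℕ) :
    v ∉ lateVisits f (Ioo u v) n := fun hu => by
  obtain ⟨k, -, hk⟩ := mem_lateVisits.1 hu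
  exact h.right_notMem k hk

/-- The component of the set of late visits containing the turning point. -/
theorem exists_component (h : NiceSetting f c ℓ u v) (n : ℕ) :
    ∃ a b, u ≤ a ∧ a < c ∧ c < b ∧ b ≤ v ∧ a ∉ lateVisits f (Ioo u v) n ∧
      b ∉ lateVisits f (Ioo u v) n ∧ ∀ x, LateJoined f (Ioo u v) n c x ↔ x ∈ Ioo a b := by
  have hc := h.omega_subset_lateVisits n h.recurrent
  have hcompact : ∀ {x y : ℝ}, u ≤ x → y ≤ v →
      IsCompact (Icc x y \ lateVisits f (Ioo u v) n) := fun hx hy =>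
    isCompact_Icc.of_isClosed_subset (h.isClosed_compl_lateVisits n isClosed_Icc
      (Icc_subset_Icc (h.nonneg.trans hx) (hy.trans h.le_one))) sdiff_subset
  obtain ⟨a, ⟨⟨hua, hac⟩, haS⟩, hmax⟩ := (hcompact le_rfl h.c_mem.2.le).exists_isGreatest
    ⟨u, ⟨le_rfl, h.c_mem.1.le⟩, h.left_notMem_lateVisits n⟩
  obtain ⟨b, ⟨⟨hcb, hbv⟩, hbS⟩, hmin⟩ := (hcompact h.c_mem.1.le le_rfl).exists_isLeast
    ⟨v, ⟨h.c_mem.2.le, le_rfl⟩, h.right_notMem_lateVisits n⟩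
  have hac' : a < c := lt_of_le_of_ne hac fun e => haS (e ▸ hc)
  have hcb' : c < b := lt_of_le_of_ne hcb fun e => hbS (e ▸ hc)
  refine ⟨a, b, hua, hac', hcb', hbv, haS, hbS, fun x => ⟨fun hj => ⟨?_, ?_⟩, fun hx z hz => ?_⟩⟩
  · by_contra! hxa
    exact haS (hj (mem_uIcc_of_ge hxa hac))
  · by_contra! hxb
    exact hbS (hj (mem_uIcc_of_le hcb hxb))
  · have hz' : z ∈ Ioo a b := ordConnected_Ioo.uIcc_subset ⟨hac', hcb'⟩ hx hz
    by_contra hzS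
    rcases le_total z c with hzc | hzc
    · exact hz'.1.not_ge (hmax ⟨⟨hua.trans hz'.1.le, hzc⟩, hzS⟩)
    · exact hz'.2.not_ge (hmin ⟨⟨hzc, hz'.2.le.trans hbv⟩, hzS⟩)

/-- A first time at which the turning point returns to its own class. -/
theorem Stable.exists_return (h : NiceSetting f c ℓ u v) {n : ℕ} (hs : Stable f c u v n) :
    ∃ q, 2 ≤ q ∧ (∀ m, LateJoined f (Ioo u v) m c (f^[q] c)) ∧
      ∀ i j, i < j → j < q → ¬ LateJoined f (Ioo u v) n (f^[i] c) (f^[j] c) := by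
  have hω := h.iterate_mem_omega
  have hex : ∃ q, 1 ≤ q ∧ LateJoined f (Ioo u v) n c (f^[q] c) := by
    obtain ⟨δ, hδ, hj⟩ := h.eventually_joined n h.recurrent
    obtain ⟨_, ⟨q, hq, rfl⟩, hd⟩ := Metric.mem_closure_iff.1 (mem_iInter.1 h.recurrent 1) δ hδ
    exact ⟨q, hq, hj _ (hω q) (by rwa [dist_comm, Real.dist_eq] at hd)⟩
  obtain ⟨hq1, hqj⟩ := Nat.find_spec hex
  set q := Nat.find hex
  refine ⟨q, ?_, Stable.joined h hs h.recurrent (hω q) hqj, fun i j hij hjq hj => ?_⟩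
  · by_contra! hlt
    obtain hq : q = 1 := by omega
    rw [hq] at hqj
    exact h.not_joined_apply n hqj
  · have himg : LateJoined f (Ioo u v) n (f^[q - j] (f^[i] c)) (f^[q - j] (f^[j] c)) :=
      (Stable.joined h hs (hω i) (hω j) hj (n + (q - j))).image_iterate
        ((h.unimodal.continuousOn_iterate _).mono (h.uIcc_subset_Icc (hω i) (hω j)))
    rw [← iterate_add_apply, ← iterate_add_apply, Nat.sub_add_cancel hjq.le] at himg
    exact Nat.find_min hex (m := q - j + i) (by omega) ⟨by omega, hqj.trans himg.symm⟩

theorem Stable.renormalizable (h : NiceSetting f c ℓ u v) {n : ℕ} (hs : Stable f c u v n) :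
    Renormalizable f c := by
  obtain ⟨q, hq2, hret, hsep⟩ := Stable.exists_return h hs
  choose α β huα hαc hcβ hβv hαS hβS hcomp using h.exists_component
  have hsubset : ∀ m, Icc (α m) (β m) ⊆ Icc 0 1 := fun m =>
    Icc_subset_Icc (h.nonneg.trans (huα m)) ((hβv m).trans h.le_one)
  have hnest : ∀ m k, m ≤ k → Ioo (α k) (β k) ⊆ Ioo (α m) (β m) := fun m k hmk x hx =>
    (hcomp m x).1 (((hcomp k x).2 hx).anti hmk)
  have hαmono : Monotone α := fun m k hmk =>
    ((Ioo_subset_Ioo_iff ((hαc k).trans (hcβ k))).1 (hnest m k hmk)).1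
  have hβanti : Antitone β := fun m k hmk =>
    ((Ioo_subset_Ioo_iff ((hαc k).trans (hcβ k))).1 (hnest m k hmk)).2
  have hαbdd : BddAbove (range α) := ⟨c, forall_mem_range.2 fun m => (hαc m).le⟩
  have hβbdd : BddBelow (range β) := ⟨c, forall_mem_range.2 fun m => (hcβ m).le⟩
  set a := ⨆ m, α m
  set b := ⨅ m, β m
  have hαa : ∀ m, α m ≤ a := le_ciSup hαbdd
  have hbβ : ∀ m, b ≤ β m := ciInf_le hβbdd
  have hac : a ≤ c := ciSup_le fun m => (hαc m).le
  have hcb : c ≤ b := le_ciInf fun m => (hcβ m).le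
  have hIsub : ∀ m, Icc a b ⊆ Icc (α m) (β m) := fun m => Icc_subset_Icc (hαa m) (hbβ m)
  have hI01 : Icc a b ⊆ Icc 0 1 := (hIsub 0).trans (hsubset 0)
  have hcont := h.unimodal.continuousOn_iterate
  have hmapsIoo : ∀ m, MapsTo f^[q] (Ioo (α (m + q)) (β (m + q))) (Ioo (α m) (β m)) := by
    intro m x hx
    refine (hcomp m _).1 ((hret m).trans (LateJoined.image_iterate ((hcont q).mono ?_)
      ((hcomp _ x).2 hx)))
    exact ordConnected_Icc.uIcc_subset h.c_mem_Icc (hsubset _ (Ioo_subset_Icc_self hx))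
  have hmapsIcc : ∀ m, MapsTo f^[q] (Icc (α (m + q)) (β (m + q))) (Icc (α m) (β m)) := by
    intro m
    have hlt : ∀ m, α m ≠ β m := fun m => ((hαc m).trans (hcβ m)).ne
    rw [← closure_Ioo (hlt m), ← closure_Ioo (hlt (m + q))]
    refine (hmapsIoo m).closure_of_continuousOn ((hcont q).mono ?_)
    rw [closure_Ioo (hlt (m + q))]
    exact hsubset _
  have hbdry : ∀ m, ∀ x ∈ Icc (α (m + q)) (β (m + q)), x ∉ lateVisits f (Ioo u v) (m + q) →
      (f^[q] x - α m) * (f^[q] x - β m) = 0 := by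
    intro m x hx hxS
    have hxS' : f^[q] x ∉ lateVisits f (Ioo u v) m := fun hmem =>
      hxS ((iterate_mem_lateVisits q).1 hmem)
    have hx' := hmapsIcc m hx
    rw [mul_eq_zero, sub_eq_zero, sub_eq_zero]
    by_contra! hne
    exact hxS' ((hcomp m _).2 ⟨lt_of_le_of_ne hx'.1 hne.1.symm, lt_of_le_of_ne hx'.2 hne.2⟩
      right_mem_uIcc)
  have hαlim : Tendsto α atTop (𝓝 a) := tendsto_atTop_ciSup hαmono hαbdd
  have hβlim : Tendsto β atTop (𝓝 b) := tendsto_atTop_ciInf hβanti hβbdd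
  have hend : ∀ (γ : ℕ → ℝ) (x : ℝ), x ∈ Icc (0 : ℝ) 1 → Tendsto γ atTop (𝓝 x) →
      (∀ m, γ m ∈ Icc (α m) (β m)) → (∀ m, γ m ∉ lateVisits f (Ioo u v) m) →
      f^[q] x = a ∨ f^[q] x = b := by
    intro γ x hx hγ hγI hγS
    have hlim : Tendsto (fun m => f^[q] (γ (m + q))) atTop (𝓝 (f^[q] x)) :=
      (hcont q x hx).tendsto.comp (tendsto_nhdsWithin_iff.2
        ⟨(tendsto_add_atTop_iff_nat q).2 hγ, Eventually.of_forall fun m => hsubset _ (hγI _)⟩)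
    have hprod := (hlim.sub hαlim).mul (hlim.sub hβlim)
    simp only [hbdry _ _ (hγI _) (hγS _)] at hprod
    have := tendsto_nhds_unique hprod tendsto_const_nhds
    rwa [mul_eq_zero, sub_eq_zero, sub_eq_zero] at this
  have hαβ : ∀ m, α m ≤ β m := fun m => ((hαc m).trans (hcβ m)).le
  have hfa : f^[q] a = a ∨ f^[q] a = b :=
    hend α a (hI01 ⟨le_rfl, hac.trans hcb⟩) hαlim (fun m => ⟨le_rfl, hαβ m⟩) hαS
  have hfb : f^[q] b = a ∨ f^[q] b = b :=
    hend β b (hI01 ⟨hac.trans hcb, le_rfl⟩) hβlim (fun m => ⟨hαβ m, le_rfl⟩) hβS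
  have hper : f^[q] c ≠ c := h.nonperiodic q (by omega)
  have hper₂ : f^[q] (f^[q] c) ≠ c := by
    rw [← iterate_add_apply]; exact h.nonperiodic _ (by omega)
  have hpre : f^[q] (f^[q] c) ≠ f^[q] c := h.iterate_ne (by omega) (by omega)
  have hac' : a < c := by
    refine lt_of_le_of_ne hac fun e => ?_
    rw [e] at hfa hfb
    have hb := hfa.resolve_left hper
    rw [← hb] at hfb
    exact hfb.elim hper₂ hpre
  have hcb' : c < b := by
    refine lt_of_le_of_ne hcb fun e => ?_
    rw [← e] at hfa hfb
    have ha := hfb.resolve_right hper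
    rw [← ha] at hfa
    exact hfa.elim hpre hper₂
  have hab : a < b := hac'.trans hcb'
  have hjoin : ∀ i, ∀ x ∈ Ioo a b, LateJoined f (Ioo u v) n (f^[i] c) (f^[i] x) := by
    intro i x hx
    refine LateJoined.image_iterate ((hcont i).mono ?_)
      ((hcomp _ x).2 (Ioo_subset_Ioo (hαa _) (hbβ _) hx))
    exact ordConnected_Icc.uIcc_subset h.c_mem_Icc (hI01 (Ioo_subset_Icc_self hx))
  have himage : ∀ i, ∀ K : Set ℝ, IsClosed K → (∀ x ∈ Ioo a b, f^[i] x ∈ K) →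
      f^[i] '' Icc a b ⊆ K := by
    intro i K hK hx
    rw [← closure_Ioo hab.ne]
    refine (ContinuousOn.image_closure ((hcont i).mono ?_)).trans
      (closure_minimal (image_subset_iff.2 hx) hK)
    rwa [closure_Ioo hab.ne]
  have hdisj : ∀ i j, f^[i] c ≤ f^[j] c → ¬ LateJoined f (Ioo u v) n (f^[i] c) (f^[j] c) →
      interior (f^[i] '' Icc a b) ∩ interior (f^[j] '' Icc a b) = ∅ := by
    intro i j hle hnj
    obtain ⟨z, hz, hzS⟩ := not_subset.1 hnj
    rw [uIcc_of_le hle] at hz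
    have hi : f^[i] '' Icc a b ⊆ Iic z := himage i _ isClosed_Iic fun x hx => by
      by_contra hlt
      exact hzS (hjoin i x hx (mem_uIcc_of_le hz.1 (not_le.1 hlt).le))
    have hj : f^[j] '' Icc a b ⊆ Ici z := himage j _ isClosed_Ici fun x hx => by
      by_contra hlt
      exact hzS (hjoin j x hx (mem_uIcc_of_ge (not_le.1 hlt).le hz.2))
    have hi' := interior_mono hi
    have hj' := interior_mono hj
    rw [interior_Iic] at hi'
    rw [interior_Ici] at hj'
    exact eq_empty_of_forall_notMem fun w hw =>
      lt_asymm (mem_Iio.1 (hi' hw.1)) (mem_Ioi.1 (hj' hw.2))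
  refine ⟨Icc a b, q, ⟨a, b, hab, rfl⟩, ?_, hq2, fun i j hij hjq => ?_, ?_, ?_⟩
  · rw [interior_Icc]
    exact ⟨hac', hcb'⟩
  · have hnj := hsep i j hij hjq
    rcases le_total (f^[i] c) (f^[j] c) with hle | hle
    · exact hdisj i j hle hnj
    · rw [inter_comm]
      exact hdisj j i hle fun hj => hnj hj.symm
  · rintro _ ⟨x, hx, rfl⟩
    exact ⟨ciSup_le fun m => (hmapsIcc m (hIsub _ hx)).1,
      le_ciInf fun m => (hmapsIcc m (hIsub _ hx)).2⟩
  · rw [frontier_Icc hab.le]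
    rintro _ ⟨x, rfl | rfl, rfl⟩
    · exact hfa
    · exact hfb

theorem lt_qCount (h : NiceSetting f c ℓ u v) (hr : ¬ Renormalizable f c) (n : ℕ) :
    n < qCount f c (Ioo u v) n := by
  induction n with
  | zero => exact h.qCount_pos 0
  | succ n ih =>
    by_contra! hle
    exact hr (Stable.renormalizable h (n := n) fun x hx y hy hxy =>
      h.joined_succ_of_qCount_le (n := n) (by omega) hx hy hxy)

end NiceSetting

theorem IsSymmNice.exists_niceSetting {f : ℝ → ℝ} {c ℓ : ℝ} {Y : Set ℝ} (hY : IsSymmNice f c Y)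
    (hf : UnimodalA f c ℓ) (hrec : c ∈ omegaLimitSet f c) (hper : ∀ p : ℕ, 1 ≤ p → f^[p] c ≠ c)
    (hmin : IsMinimalOn f (omegaLimitSet f c)) :
    ∃ u v, Y = Ioo u v ∧ NiceSetting f c ℓ u v := by
  obtain ⟨⟨⟨u, v, huv, rfl⟩, hsub, hnice, hfix⟩, hc, -⟩ := hY
  rw [frontier_Ioo huv] at hnice
  have hsub' : Icc u v ⊆ Icc 0 1 := by
    rw [← closure_Ioo huv.ne]
    exact closure_minimal hsub isClosed_Icc
  exact ⟨u, v, rfl, hf, hrec, hper, hmin, hc, (hsub' (left_mem_Icc.2 huv.le)).1,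
    (hsub' (right_mem_Icc.2 huv.le)).2, fun n => hnice n u (Or.inl rfl),
    fun n => hnice n v (Or.inr rfl), hfix⟩

/-- Theorem 5.5: for non-renormalizable `f ∈ 𝒜₊` with non-periodic recurrent critical
point `c` and `ω(c)` minimal, and any symmetric nice interval `Y`,
`q(𝒴, n) ≥ κ₀ n` for all large `n`, with `κ₀ > 0` universal. -/
theorem qCount_linear_lower_bound :
    ∃ κ₀ > 0, ∀ f : ℝ → ℝ, ∀ c ℓ : ℝ, UnimodalAStar f c ℓ →
      ¬ Renormalizable f c → c ∈ omegaLimitSet f c →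
      (∀ p : ℕ, 1 ≤ p → f^[p] c ≠ c) → IsMinimalOn f (omegaLimitSet f c) →
      ∀ Y : Set ℝ, IsSymmNice f c Y →
        ∃ N : ℕ, ∀ n : ℕ, N ≤ n → κ₀ * (n : ℝ) ≤ (qCount f c Y n : ℝ) := by
  refine ⟨1, one_pos, fun f c ℓ hf hr hrec hper hmin Y hY => ⟨0, fun n _ => ?_⟩⟩
  obtain ⟨u, v, rfl, h⟩ := hY.exists_niceSetting hf.1 hrec hper hmin
  rw [one_mul]
  exact_mod_cast (h.lt_qCount hr n).le
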